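/- arXiv:2209.00715 — 5 statements merged into one kernel-verified Lean document; each statement's English description precedes it below -/
import Mathlib

section
/- For each q ∈ B, the zero component 0 belongs to M(q), and M(q) possesses a maximal element (with respect to the order of E). -/
/-- In a (Dedekind complete) Riesz space `E`, the band projection of `x` onto the
band generated by `u`, given by `P_u x = sup_n (x⁺ ⊓ n|u|) - sup_n (x⁻ ⊓ n|u|)`.
For a component `p` of a weak order unit this is the product `p x`. -/
noncomputable def bandProj {E : Type*} [AddCommGroup E] [ConditionallyCompleteLattice E]
    [CovariantClass E E (· + ·) (· ≤ ·)] (u x : E) : E :=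
  sSup (Set.range fun n : ℕ => (x ⊔ 0) ⊓ n • |u|) -
    sSup (Set.range fun n : ℕ => ((-x) ⊔ 0) ⊓ n • |u|)

/-- `p` is a component of the weak order unit `e`: `0 ≤ p ≤ e` and `p ∧ (e - p) = 0`. -/
def IsComponent {E : Type*} [AddCommGroup E] [Lattice E] (e p : E) : Prop :=
  0 ≤ p ∧ p ≤ e ∧ p ⊓ (e - p) = 0

/-- The setting of the abstract Hahn-Jordan decomposition: a Dedekind complete Riesz
space `E` with weak order unit `e`, a Dedekind complete Riesz subspace `G` of `E`
containing `e`, an order closed Boolean subalgebra `B` of the components of `e`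
containing all components of `e` lying in `G`, and a map `ψ : B → G` which is
`K_G(e)`-homogeneous, additive on disjoint components, order continuous and order
bounded. -/
structure HJSetup (E : Type*) [AddCommGroup E] [ConditionallyCompleteLattice E]
    [CovariantClass E E (· + ·) (· ≤ ·)] [Module ℝ E] [PosSMulMono ℝ E] where
  /-- the weak order unit -/
  e : E
  /-- the Dedekind complete Riesz subspace `G` -/
  G : Set E
  /-- the Boolean algebra `B` of components of `e` -/
  B : Set E
  /-- the map `ψ : B → G` (values outside `B` are irrelevant) -/
  ψ : E → E
  e_pos : 0 < e
  e_weak : ∀ x : E, 0 ≤ x → x ⊓ e = 0 → x = 0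
  G_zero : (0 : E) ∈ G
  G_add : ∀ x ∈ G, ∀ y ∈ G, x + y ∈ G
  G_neg : ∀ x ∈ G, -x ∈ G
  G_smul : ∀ (c : ℝ), ∀ x ∈ G, c • x ∈ G
  G_sup : ∀ x ∈ G, ∀ y ∈ G, x ⊔ y ∈ G
  G_inf : ∀ x ∈ G, ∀ y ∈ G, x ⊓ y ∈ G
  /-- `G` is Dedekind complete (order closed in `E`) -/
  G_ded : ∀ S ⊆ G, S.Nonempty → BddAbove S → sSup S ∈ G
  e_mem : e ∈ G
  B_comp : ∀ p ∈ B, IsComponent e p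
  B_zero : (0 : E) ∈ B
  B_top : e ∈ B
  B_sup : ∀ p ∈ B, ∀ q ∈ B, p ⊔ q ∈ B
  B_inf : ∀ p ∈ B, ∀ q ∈ B, p ⊓ q ∈ B
  B_compl : ∀ p ∈ B, e - p ∈ B
  /-- `K_G(e) ⊆ B` -/
  KG_sub : ∀ p, IsComponent e p → p ∈ G → p ∈ B
  /-- `B` is order closed in `E`: if a (downward directed) net in `B` decreases to `p`
  in `E`, then `p ∈ B` -/
  B_orderClosed : ∀ S ⊆ B, S.Nonempty → DirectedOn (· ≥ ·) S → sInf S ∈ B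
  ψ_mem : ∀ p ∈ B, ψ p ∈ G
  /-- (i) `ψ(pq) = q ψ(p)` for `p ∈ B`, `q ∈ K_G(e)` -/
  ψ_mul : ∀ p ∈ B, ∀ q, IsComponent e q → q ∈ G → ψ (p ⊓ q) = bandProj q (ψ p)
  /-- (ii) additivity on disjoint components -/
  ψ_add : ∀ p ∈ B, ∀ q ∈ B, p ⊓ q = 0 → ψ (p ⊔ q) = ψ p + ψ q
  /-- (iii) order continuity: if a net `(p_α)` in `B` decreases to `p` in `E`, then
  `ψ(p_α) → ψ(p)` in order -/
  ψ_ordCont : ∀ S ⊆ B, S.Nonempty → DirectedOn (· ≥ ·) S →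
    ∃ w : E → E, (∀ p ∈ S, ∀ q ∈ S, p ≤ q → w p ≤ w q) ∧
      sInf (w '' S) = 0 ∧ ∀ p ∈ S, |ψ p - ψ (sInf S)| ≤ w p
  /-- (iv) `ψ` is order bounded -/
  ψ_bdd : ∃ g : E, 0 ≤ g ∧ ∀ p ∈ B, |ψ p| ≤ g

namespace HJSetup

variable {E : Type*} [AddCommGroup E] [ConditionallyCompleteLattice E]
  [CovariantClass E E (· + ·) (· ≤ ·)] [Module ℝ E] [PosSMulMono ℝ E]

/-- `C(q) = {ψ(p) : p ∈ B, p ≤ q}`. -/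
def C (s : HJSetup E) (q : E) : Set E := {y | ∃ p ∈ s.B, p ≤ q ∧ y = s.ψ p}

/-- `α(q) = sup C(q)`. -/
noncomputable def alpha (s : HJSetup E) (q : E) : E := sSup (s.C q)

/-- `M(q) = {p ∈ B : p ≤ q, 2ψ(p) ≥ p α(q)}`. -/
def M (s : HJSetup E) (q : E) : Set E :=
  {p | p ∈ s.B ∧ p ≤ q ∧ bandProj p (s.alpha q) ≤ s.ψ p + s.ψ p}

/-- `q` is strongly positive with respect to `ψ`. -/
def StronglyPos (s : HJSetup E) (q : E) : Prop := ∀ p ∈ s.B, p ≤ q → 0 ≤ s.ψ p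

/-- `q` is strongly negative with respect to `ψ`. -/
def StronglyNeg (s : HJSetup E) (q : E) : Prop := ∀ p ∈ s.B, p ≤ q → s.ψ p ≤ 0

/-- `H = {p ∈ B : p strongly negative w.r.t. ψ}`. -/
def H (s : HJSetup E) : Set E := {p | p ∈ s.B ∧ s.StronglyNeg p}

end HJSetup

section LatticeOrderedGroup

variable {E : Type*} [AddCommGroup E] [ConditionallyCompleteLattice E]
  [CovariantClass E E (· + ·) (· ≤ ·)]

/-- Natural multiples preserve suprema of chains. -/
theorem IsChain.isLUB_nsmul {c : Set E} (hc : IsChain (· ≤ ·) c) {u : E} (hu : IsLUB c u)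
    (n : ℕ) {z : E} (hz : ∀ p ∈ c, n • p ≤ z) (hne : c.Nonempty) : n • u ≤ z := by
  induction n generalizing z with
  | zero =>
    obtain ⟨p, hp⟩ := hne
    simpa using hz p hp
  | succ n ih =>
    have key : ∀ p ∈ c, ∀ r ∈ c, n • p + r ≤ z := by
      intro p hp r hr
      rcases hc.total hp hr with h | h
      · calc n • p + r ≤ n • r + r := add_le_add_left (nsmul_le_nsmul_right h n) r
          _ = (n + 1) • r := (succ_nsmul r n).symm
          _ ≤ z := hz r hr
      · calc n • p + r ≤ n • p + p := add_le_add_right h (n • p)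
          _ = (n + 1) • p := (succ_nsmul p n).symm
          _ ≤ z := hz p hp
    have hnu : n • u ≤ z - u := by
      refine ih fun p hp => ?_
      have : u ≤ z - n • p := hu.2 fun r hr => le_sub_iff_add_le'.2 (key p hp r hr)
      exact le_sub_iff_add_le.2 (le_sub_iff_add_le'.1 this)
    rw [succ_nsmul]
    exact le_sub_iff_add_le.1 hnu

/-- Infimum with a fixed element distributes over multiples of suprema of chains. -/
theorem IsChain.inf_nsmul_le {c : Set E} (hc : IsChain (· ≤ ·) c) {u : E} (hu : IsLUB c u)
    (hne : c.Nonempty) (n : ℕ) {a x : E} (hx : ∀ p ∈ c, a ⊓ n • p ≤ x) : a ⊓ n • u ≤ x := by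
  have h : ∀ p ∈ c, n • p ≤ n • u - (a ⊓ n • u - x) := by
    intro p hp
    have hpu : n • p ≤ n • u := nsmul_le_nsmul_right (hu.1 hp) n
    have h1 : a ⊓ n • u ≤ a ⊓ n • p + (n • u - n • p) := by
      rw [inf_add]
      refine inf_le_inf ?_ (by simp)
      exact le_add_of_nonneg_right (sub_nonneg.2 hpu)
    have h2 := h1.trans (add_le_add_left (hx p hp) _)
    have h3 := sub_nonneg.2 h2
    rw [← sub_nonneg]
    convert h3 using 1
    abel
  have := hc.isLUB_nsmul hu n h hne
  simpa using this

theorem bandProj_of_nonneg {u x : E} (hu : 0 ≤ u) (hx : 0 ≤ x) :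
    bandProj u x = sSup (Set.range fun n : ℕ => x ⊓ n • u) := by
  have h : (fun n : ℕ => (-x ⊔ 0) ⊓ n • u) = fun _ => 0 := by
    funext n
    rw [sup_eq_right.2 (neg_nonpos.2 hx), inf_eq_left.2 (nsmul_nonneg hu n)]
  simp [bandProj, abs_of_nonneg hu, sup_eq_left.2 hx, h]

theorem inf_nsmul_le_bandProj {u x : E} (hu : 0 ≤ u) (hx : 0 ≤ x) (n : ℕ) :
    x ⊓ n • u ≤ bandProj u x := by
  rw [bandProj_of_nonneg hu hx]
  refine le_csSup ⟨x, ?_⟩ ⟨n, rfl⟩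
  rintro _ ⟨k, rfl⟩
  exact inf_le_left

theorem bandProj_le {u x y : E} (hu : 0 ≤ u) (hx : 0 ≤ x) (h : ∀ n : ℕ, x ⊓ n • u ≤ y) :
    bandProj u x ≤ y := by
  rw [bandProj_of_nonneg hu hx]
  refine csSup_le (Set.range_nonempty _) ?_
  rintro _ ⟨k, rfl⟩
  exact h k

theorem bandProj_mono {u v x : E} (hu : 0 ≤ u) (huv : u ≤ v) (hx : 0 ≤ x) :
    bandProj u x ≤ bandProj v x :=
  bandProj_le hu hx fun n =>
    (inf_le_inf_left x (nsmul_le_nsmul_right huv n)).trans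
      (inf_nsmul_le_bandProj (hu.trans huv) hx n)

end LatticeOrderedGroup

namespace HJSetup

variable {E : Type*} [AddCommGroup E] [ConditionallyCompleteLattice E]
  [CovariantClass E E (· + ·) (· ≤ ·)] [Module ℝ E] [PosSMulMono ℝ E] (s : HJSetup E)

theorem ψ_zero : s.ψ 0 = 0 := by
  have h := s.ψ_add 0 s.B_zero 0 s.B_zero (by simp)
  simpa using h

theorem ψ_compl {p : E} (hp : p ∈ s.B) : s.ψ (s.e - p) = s.ψ s.e - s.ψ p := by
  have hd := (s.B_comp p hp).2.2
  have h := s.ψ_add p hp _ (s.B_compl p hp) hd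
  have hsup : p ⊔ (s.e - p) = s.e := by
    have := inf_add_sup p (s.e - p)
    rwa [hd, zero_add, add_sub_cancel] at this
  rw [hsup] at h
  rw [h, add_sub_cancel_left]

theorem alpha_nonneg {q : E} (hq : q ∈ s.B) : 0 ≤ s.alpha q := by
  obtain ⟨g, -, hg⟩ := s.ψ_bdd
  refine le_csSup ⟨g, ?_⟩ ⟨0, s.B_zero, (s.B_comp q hq).1, s.ψ_zero.symm⟩
  rintro _ ⟨p, hp, -, rfl⟩
  exact (le_abs_self _).trans (hg p hp)

theorem zero_mem_M {q : E} (hq : q ∈ s.B) : (0 : E) ∈ s.M q := by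
  refine ⟨s.B_zero, (s.B_comp q hq).1, ?_⟩
  rw [s.ψ_zero, add_zero]
  exact bandProj_le le_rfl (s.alpha_nonneg hq) fun n => by simp

/-- The supremum of a nonempty chain `c` in `B` lies in `B`, and `ψ` converges in order to its
value there along `c`. -/
theorem exists_orderConvergence_of_isChain {c : Set E} (hcB : c ⊆ s.B)
    (hc : IsChain (· ≤ ·) c) (hne : c.Nonempty) :
    sSup c ∈ s.B ∧ ∃ w : E → E, AntitoneOn w c ∧ (∀ a, (∀ p ∈ c, a ≤ w p) → a ≤ 0) ∧
      ∀ p ∈ c, |s.ψ p - s.ψ (sSup c)| ≤ w p := by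
  have hlub : IsLUB c (sSup c) := isLUB_csSup hne ⟨s.e, fun p hp => (s.B_comp p (hcB hp)).2.1⟩
  set S : Set E := (fun p => s.e - p) '' c with hS
  have hSB : S ⊆ s.B := by
    rintro _ ⟨p, hp, rfl⟩
    exact s.B_compl p (hcB hp)
  have hSne : S.Nonempty := hne.image _
  have hSdir : DirectedOn (· ≥ ·) S := by
    rintro _ ⟨p, hp, rfl⟩ _ ⟨r, hr, rfl⟩
    rcases hc.total hp hr with h | h
    · exact ⟨s.e - r, ⟨r, hr, rfl⟩, sub_le_sub_left h _, le_rfl⟩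
    · exact ⟨s.e - p, ⟨p, hp, rfl⟩, le_rfl, sub_le_sub_left h _⟩
  have hinf : sInf S = s.e - sSup c := by
    refine IsGLB.csInf_eq ⟨?_, fun b hb => ?_⟩ hSne
    · rintro _ ⟨p, hp, rfl⟩
      exact sub_le_sub_left (hlub.1 hp) _
    · exact le_sub_comm.1 (hlub.2 fun p hp => le_sub_comm.1 (hb ⟨p, hp, rfl⟩))
  have huB : sSup c ∈ s.B := by
    have h := s.B_compl _ (s.B_orderClosed S hSB hSne hSdir)
    rwa [hinf, sub_sub_cancel] at h
  obtain ⟨w, hw_mono, hw_inf, hw_le⟩ := s.ψ_ordCont S hSB hSne hSdir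
  refine ⟨huB, fun p => w (s.e - p), ?_, fun a ha => ?_, fun p hp => ?_⟩
  · exact fun p hp r hr hpr => hw_mono _ ⟨r, hr, rfl⟩ _ ⟨p, hp, rfl⟩ (sub_le_sub_left hpr _)
  · rw [← hw_inf]
    refine le_csInf (hSne.image w) ?_
    rintro _ ⟨_, ⟨p, hp, rfl⟩, rfl⟩
    exact ha p hp
  · have h := hw_le _ ⟨p, hp, rfl⟩
    rwa [hinf, s.ψ_compl (hcB hp), s.ψ_compl huB, sub_sub_sub_cancel_left, abs_sub_comm] at h

theorem sSup_mem_M {q : E} (hq : q ∈ s.B) {c : Set E} (hcM : c ⊆ s.M q)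
    (hc : IsChain (· ≤ ·) c) (hne : c.Nonempty) : sSup c ∈ s.M q := by
  have hcB : c ⊆ s.B := fun p hp => (hcM hp).1
  have hlub : IsLUB c (sSup c) := isLUB_csSup hne ⟨q, fun p hp => (hcM hp).2.1⟩
  obtain ⟨huB, w, hw_anti, hw_inf, hw_le⟩ := s.exists_orderConvergence_of_isChain hcB hc hne
  have hα := s.alpha_nonneg hq
  refine ⟨huB, hlub.2 fun p hp => (hcM hp).2.1, ?_⟩
  set b := s.ψ (sSup c) + s.ψ (sSup c) with hb
  have hstep : ∀ p ∈ c, bandProj p (s.alpha q) ≤ b + (w p + w p) := by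
    intro p hp
    have h : s.ψ p ≤ s.ψ (sSup c) + w p :=
      sub_le_iff_le_add'.1 ((le_abs_self _).trans (hw_le p hp))
    calc bandProj p (s.alpha q) ≤ s.ψ p + s.ψ p := (hcM hp).2.2
      _ ≤ (s.ψ (sSup c) + w p) + (s.ψ (sSup c) + w p) := add_le_add h h
      _ = b + (w p + w p) := by rw [hb]; abel
  have hdiag : ∀ p ∈ c, ∀ r ∈ c, bandProj p (s.alpha q) ≤ b + (w r + w r) := by
    intro p hp r hr
    rcases hc.total hp hr with h | h
    · exact (bandProj_mono (s.B_comp p (hcB hp)).1 h hα).trans (hstep r hr)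
    · have hw := hw_anti hr hp h
      exact (hstep p hp).trans (add_le_add le_rfl (add_le_add hw hw))
  have hmix : ∀ p ∈ c, ∀ r ∈ c, ∀ t ∈ c, bandProj p (s.alpha q) ≤ b + (w r + w t) := by
    intro p hp r hr t ht
    rcases hc.total hr ht with h | h
    · exact (hdiag p hp t ht).trans
        (add_le_add le_rfl (add_le_add (hw_anti hr ht h) le_rfl))
    · exact (hdiag p hp r hr).trans
        (add_le_add le_rfl (add_le_add le_rfl (hw_anti ht hr h)))
  have hbound : ∀ p ∈ c, bandProj p (s.alpha q) ≤ b := by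
    intro p hp
    rw [← sub_nonpos]
    refine hw_inf _ fun r hr => ?_
    rw [← sub_nonpos]
    refine hw_inf _ fun t ht => ?_
    rw [sub_le_iff_le_add', sub_le_iff_le_add']
    exact hmix p hp r hr t ht
  refine bandProj_le (s.B_comp _ huB).1 hα fun n => hc.inf_nsmul_le hlub hne n fun p hp => ?_
  exact (inf_nsmul_le_bandProj (s.B_comp p (hcB hp)).1 hα n).trans (hbound p hp)

end HJSetup

/-- For each `q ∈ B`, `0 ∈ M(q)` and `M(q)` has a maximal element. -/
theorem hj_M_zero_mem_and_has_maximal {E : Type*} [AddCommGroup E]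
    [ConditionallyCompleteLattice E] [CovariantClass E E (· + ·) (· ≤ ·)]
    [Module ℝ E] [PosSMulMono ℝ E] (s : HJSetup E) (q : E) (hq : q ∈ s.B) :
    (0 : E) ∈ s.M q ∧ ∃ m ∈ s.M q, ∀ p ∈ s.M q, m ≤ p → p = m := by
  refine ⟨s.zero_mem_M hq, ?_⟩
  obtain ⟨m, -, hm⟩ := zorn_le_nonempty₀ (s.M q)
    (fun c hcM hc p hp => ⟨sSup c, s.sSup_mem_M hq hcM hc ⟨p, hp⟩,
      fun r hr => le_csSup ⟨q, fun t ht => (hcM ht).2.1⟩ hr⟩) 0 (s.zero_mem_M hq)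
  exact ⟨m, hm.prop, fun p hp hmp => (hm.eq_of_le hp hmp).symm⟩
end

section
/- For q ∈ B and q̂ a maximal element of M(q), one has (α(q) − 2ψ(q̂))⁺ q̂ = 0, i.e. (α(q) − 2ψ(q̂))⁺ and q̂ are disjoint in E; consequently q̂(α(q) − 2ψ(q̂)) ≤ 0. -/
section BandProj

variable {E : Type*} [AddCommGroup E] [ConditionallyCompleteLattice E]

theorem bddAbove_range_inf_nsmul (u p : E) :
    BddAbove (Set.range fun n : ℕ => u ⊓ n • p) :=
  ⟨u, by rintro _ ⟨n, rfl⟩; exact inf_le_left⟩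

theorem csSup_range_inf_nsmul_le (u p : E) :
    sSup (Set.range fun n : ℕ => u ⊓ n • p) ≤ u :=
  csSup_le (Set.range_nonempty _) (by rintro _ ⟨n, rfl⟩; exact inf_le_left)

theorem csSup_range_inf_nsmul_nonneg {u : E} (hu : 0 ≤ u) (p : E) :
    0 ≤ sSup (Set.range fun n : ℕ => u ⊓ n • p) :=
  le_csSup (bddAbove_range_inf_nsmul u p) ⟨0, by simpa using hu⟩

variable [CovariantClass E E (· + ·) (· ≤ ·)]

theorem inf_nsmul_eq_zero_of_inf_eq_zero {z p : E} (hz : 0 ≤ z) (hp : 0 ≤ p)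
    (h : z ⊓ p = 0) (n : ℕ) : z ⊓ n • p = 0 := by
  induction n with
  | zero => simpa using hz
  | succ n ih =>
    have hnp : 0 ≤ n • p := nsmul_nonneg hp n
    apply le_antisymm
    · have h₁ : z ⊓ (n + 1) • p - n • p ≤ z ⊓ p := by
        refine le_inf ?_ ?_
        · exact (sub_le_self _ hnp).trans inf_le_left
        · rw [sub_le_iff_le_add', ← succ_nsmul]
          exact inf_le_right
      rw [h, sub_nonpos] at h₁
      exact (le_inf inf_le_left h₁).trans ih.le
    · exact le_inf hz (nsmul_nonneg hp _)

theorem csSup_range_inf_nsmul_eq_zero {z p : E} (hz : 0 ≤ z) (hp : 0 ≤ p)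
    (h : z ⊓ p = 0) : sSup (Set.range fun n : ℕ => z ⊓ n • p) = 0 := by
  simp [inf_nsmul_eq_zero_of_inf_eq_zero hz hp h]

/-- The component of a positive element in the disjoint complement of `p` is disjoint
from `p`. -/
theorem sub_csSup_range_inf_nsmul_inf_eq_zero {p : E} (u : E) (hp : 0 ≤ p) :
    (u - sSup (Set.range fun n : ℕ => u ⊓ n • p)) ⊓ p = 0 := by
  set s := sSup (Set.range fun n : ℕ => u ⊓ n • p)
  apply le_antisymm
  · have h : s ≤ s - (u - s) ⊓ p := by
      refine csSup_le (Set.range_nonempty _) ?_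
      rintro _ ⟨n, rfl⟩
      have hs : ∀ m : ℕ, u ⊓ m • p ≤ s := fun m =>
        le_csSup (bddAbove_range_inf_nsmul u p) ⟨m, rfl⟩
      refine le_sub_iff_add_le.mpr (le_trans (le_inf ?_ ?_) (hs (n + 1)))
      · calc u ⊓ n • p + (u - s) ⊓ p ≤ s + (u - s) := add_le_add (hs n) inf_le_left
          _ = u := add_sub_cancel _ _
      · rw [succ_nsmul]
        exact add_le_add inf_le_right inf_le_right
    simpa using h
  · exact le_inf (sub_nonneg.mpr (csSup_range_inf_nsmul_le u p)) hp

theorem bandProj_eq_zero_of_inf_eq_zero {p z : E} (hp : 0 ≤ p) (hz : 0 ≤ z)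
    (h : z ⊓ p = 0) : bandProj p z = 0 := by
  have hn : (-z) ⊔ 0 = 0 := sup_eq_right.mpr (neg_nonpos.mpr hz)
  rw [bandProj, abs_of_nonneg hp, hn, sup_eq_left.mpr hz,
    csSup_range_inf_nsmul_eq_zero hz hp h,
    csSup_range_inf_nsmul_eq_zero le_rfl hp (inf_eq_left.mpr hp), sub_zero]

theorem bandProj_nonpos_of_posPart_inf_eq_zero {p x : E} (hp : 0 ≤ p)
    (h : (x ⊔ 0) ⊓ p = 0) : bandProj p x ≤ 0 := by
  rw [bandProj, abs_of_nonneg hp, csSup_range_inf_nsmul_eq_zero le_sup_right hp h, zero_sub]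
  exact neg_nonpos.mpr (csSup_range_inf_nsmul_nonneg le_sup_right p)

/-- If the band projection of `a` along `p` is dominated by `y`, then the positive part
of `a - y` is disjoint from `p`. -/
theorem posPart_sub_inf_eq_zero_of_bandProj_le {p a y : E} (hp : 0 ≤ p)
    (h : bandProj p a ≤ y) : ((a - y) ⊔ 0) ⊓ p = 0 := by
  rw [bandProj, abs_of_nonneg hp] at h
  have hneg := csSup_range_inf_nsmul_le ((-a) ⊔ 0) p
  have hpos := csSup_range_inf_nsmul_le (a ⊔ 0) p
  have hdisj := sub_csSup_range_inf_nsmul_inf_eq_zero (a ⊔ 0) hp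
  set s := sSup (Set.range fun n : ℕ => (a ⊔ 0) ⊓ n • p)
  set t := sSup (Set.range fun n : ℕ => ((-a) ⊔ 0) ⊓ n • p)
  have ha : a = (a ⊔ 0) - ((-a) ⊔ 0) := (posPart_sub_negPart a).symm
  have hle : (a - y) ⊔ 0 ≤ (a ⊔ 0) - s := by
    refine sup_le ?_ (sub_nonneg.mpr hpos)
    calc a - y ≤ a - (s - t) := sub_le_sub_left h a
      _ = (a ⊔ 0) - s - (((-a) ⊔ 0) - t) := by
        nth_rewrite 1 [ha]
        abel
      _ ≤ (a ⊔ 0) - s := sub_le_self _ (sub_nonneg.mpr hneg)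
  exact le_antisymm ((inf_le_inf_right p hle).trans hdisj.le) (le_inf le_sup_right hp)

end BandProj

/-- For `q ∈ B` and `q̂` a maximal element of `M(q)`,
`(α(q) - 2ψ(q̂))⁺ q̂ = 0`, i.e. `(α(q) - 2ψ(q̂))⁺` and `q̂` are disjoint in `E`;
consequently `q̂ (α(q) - 2ψ(q̂)) ≤ 0`. -/
theorem hj_disjointness {E : Type*} [AddCommGroup E]
    [ConditionallyCompleteLattice E] [CovariantClass E E (· + ·) (· ≤ ·)]
    [Module ℝ E] [PosSMulMono ℝ E] (s : HJSetup E) (q : E) (hq : q ∈ s.B)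
    (qhat : E) (hqhat : qhat ∈ s.M q) (hmax : ∀ p ∈ s.M q, qhat ≤ p → p = qhat) :
    bandProj qhat ((s.alpha q - (s.ψ qhat + s.ψ qhat)) ⊔ 0) = 0 ∧
    ((s.alpha q - (s.ψ qhat + s.ψ qhat)) ⊔ 0) ⊓ qhat = 0 ∧
    bandProj qhat (s.alpha q - (s.ψ qhat + s.ψ qhat)) ≤ 0 := by
  have hp : 0 ≤ qhat := (s.B_comp qhat hqhat.1).1
  have h := posPart_sub_inf_eq_zero_of_bandProj_le hp hqhat.2.2
  exact ⟨bandProj_eq_zero_of_inf_eq_zero hp le_sup_right h, h,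
    bandProj_nonpos_of_posPart_inf_eq_zero hp h⟩
end

section
/- Let q ∈ B, let q̂ be a maximal element of M(q), let Q be the band projection onto the band in E generated by (α(q) − 2ψ(q̂))⁺, and set k := Qe. Then k ∈ K_G(e) ⊆ B, and if kα(q) > 0 then there exists p₀ ∈ B with p₀ ≤ q such that k(2ψ(p₀) − α(q)) is not ≤ 0. -/
section BandProjection

variable {E : Type*} [AddCommGroup E] [ConditionallyCompleteLattice E]

/-- The band projection `sup_n (x ⊓ n v)` of a positive element `x` onto the band
generated by a positive element `v`. -/
noncomputable def posBandProj (v x : E) : E := sSup (Set.range fun n : ℕ => x ⊓ n • v)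

lemma inf_nsmul_le_posBandProj (v x : E) (n : ℕ) : x ⊓ n • v ≤ posBandProj v x :=
  le_csSup ⟨x, by rintro _ ⟨m, rfl⟩; exact inf_le_left⟩ ⟨n, rfl⟩

lemma posBandProj_le {v x c : E} (h : ∀ n : ℕ, x ⊓ n • v ≤ c) : posBandProj v x ≤ c :=
  csSup_le (Set.range_nonempty _) (by rintro _ ⟨n, rfl⟩; exact h n)

lemma posBandProj_le_self (v x : E) : posBandProj v x ≤ x :=
  posBandProj_le fun _ => inf_le_left

lemma posBandProj_nonneg (v : E) {x : E} (hx : 0 ≤ x) : 0 ≤ posBandProj v x :=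
  (le_inf hx (by simp)).trans (inf_nsmul_le_posBandProj v x 0)

variable [CovariantClass E E (· + ·) (· ≤ ·)]

lemma bandProj_eq (u x : E) :
    bandProj u x = posBandProj |u| (x ⊔ 0) - posBandProj |u| ((-x) ⊔ 0) := rfl

lemma add_inf_le_inf_add_inf {x y z : E} (hx : 0 ≤ x) (hy : 0 ≤ y) (hz : 0 ≤ z) :
    (x + y) ⊓ z ≤ x ⊓ z + y ⊓ z := by
  rw [add_inf, inf_add, inf_add]
  refine le_inf (le_inf inf_le_left ?_) (le_inf ?_ ?_) <;> refine inf_le_right.trans ?_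
  · exact le_add_of_nonneg_right hy
  · exact le_add_of_nonneg_left hx
  · exact le_add_of_nonneg_right hz

lemma posBandProj_add {v x y : E} (hv : 0 ≤ v) (hx : 0 ≤ x) (hy : 0 ≤ y) :
    posBandProj v (x + y) = posBandProj v x + posBandProj v y := by
  apply le_antisymm
  · exact posBandProj_le fun n =>
      (add_inf_le_inf_add_inf hx hy (nsmul_nonneg hv n)).trans
        (add_le_add (inf_nsmul_le_posBandProj v x n) (inf_nsmul_le_posBandProj v y n))
  · rw [← le_sub_iff_add_le]
    refine posBandProj_le fun n => ?_
    rw [le_sub_comm]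
    refine posBandProj_le fun m => ?_
    rw [le_sub_iff_add_le']
    refine le_trans (le_inf (add_le_add inf_le_left inf_le_left) ?_)
      (inf_nsmul_le_posBandProj v (x + y) (n + m))
    rw [add_nsmul]
    exact add_le_add inf_le_right inf_le_right

lemma sup_zero_sub_neg_sup_zero (x : E) : (x ⊔ 0) - ((-x) ⊔ 0) = x :=
  posPart_sub_negPart x

lemma bandProj_sub_of_nonneg (u : E) {a b : E} (ha : 0 ≤ a) (hb : 0 ≤ b) :
    bandProj u (a - b) = posBandProj |u| a - posBandProj |u| b := by
  have h := sup_zero_sub_neg_sup_zero (a - b)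
  rw [sub_eq_sub_iff_add_eq_add] at h
  rw [bandProj_eq, sub_eq_sub_iff_add_eq_add,
    ← posBandProj_add (abs_nonneg u) le_sup_right hb,
    ← posBandProj_add (abs_nonneg u) ha le_sup_right, h]

lemma bandProj_of_nonneg_s2 (u : E) {x : E} (hx : 0 ≤ x) : bandProj u x = posBandProj |u| x := by
  have h0 : posBandProj |u| (0 : E) = 0 :=
    le_antisymm (posBandProj_le_self _ _) (posBandProj_nonneg _ le_rfl)
  simpa [h0] using bandProj_sub_of_nonneg u hx (le_refl (0 : E))

lemma bandProj_sub (u x y : E) : bandProj u (x - y) = bandProj u x - bandProj u y := by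
  have h : x - y = ((x ⊔ 0) + ((-y) ⊔ 0)) - (((-x) ⊔ 0) + (y ⊔ 0)) := by
    nth_rw 1 [← sup_zero_sub_neg_sup_zero x, ← sup_zero_sub_neg_sup_zero y]
    abel
  rw [h, bandProj_sub_of_nonneg u (add_nonneg le_sup_right le_sup_right)
      (add_nonneg le_sup_right le_sup_right),
    posBandProj_add (abs_nonneg u) le_sup_right le_sup_right,
    posBandProj_add (abs_nonneg u) le_sup_right le_sup_right, bandProj_eq, bandProj_eq]
  abel

lemma bandProj_add (u x y : E) : bandProj u (x + y) = bandProj u x + bandProj u y := by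
  have h := bandProj_sub u (x + y) y
  rw [add_sub_cancel_right] at h
  rw [h, sub_add_cancel]

/-- The complementary projection `x ↦ x - P_u x` is monotone. -/
lemma sub_bandProj_le_sub_bandProj (u : E) {x y : E} (h : x ≤ y) :
    x - bandProj u x ≤ y - bandProj u y := by
  have hle : bandProj u (y - x) ≤ y - x := by
    rw [bandProj_of_nonneg_s2 u (sub_nonneg.2 h)]
    exact posBandProj_le_self _ _
  rw [bandProj_sub] at hle
  rw [← sub_nonneg] at hle ⊢
  convert hle using 1
  abel

lemma sub_posBandProj_inf {v : E} (hv : 0 ≤ v) (x : E) :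
    (x - posBandProj v x) ⊓ v = 0 := by
  refine le_antisymm ?_ (le_inf (sub_nonneg.2 (posBandProj_le_self v x)) hv)
  have h : posBandProj v x ≤ posBandProj v x - (x - posBandProj v x) ⊓ v := by
    refine posBandProj_le fun n => ?_
    rw [le_sub_iff_add_le]
    refine le_trans (le_inf ?_ ?_) (inf_nsmul_le_posBandProj v x (n + 1))
    · refine (add_le_add (inf_nsmul_le_posBandProj v x n) inf_le_left).trans ?_
      rw [add_sub_cancel]
    · rw [succ_nsmul]
      exact add_le_add inf_le_right inf_le_right
  simpa using h

lemma inf_nsmul_eq_zero {y v : E} (hy : 0 ≤ y) (hv : 0 ≤ v) (h : y ⊓ v = 0) (n : ℕ) :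
    y ⊓ n • v = 0 := by
  induction n with
  | zero => simpa using hy
  | succ n ih =>
    refine le_antisymm ?_ (le_inf hy (nsmul_nonneg hv _))
    rw [succ_nsmul, inf_comm]
    refine (add_inf_le_inf_add_inf (nsmul_nonneg hv n) hv hy).trans ?_
    rw [inf_comm, ih, inf_comm, h, add_zero]

lemma isComponent_posBandProj {v x : E} (hv : 0 ≤ v) (hx : 0 ≤ x) :
    IsComponent x (posBandProj v x) := by
  refine ⟨posBandProj_nonneg v hx, posBandProj_le_self v x, ?_⟩
  have hr : 0 ≤ x - posBandProj v x := sub_nonneg.2 (posBandProj_le_self v x)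
  set y := posBandProj v x ⊓ (x - posBandProj v x) with hy
  have hy0 : 0 ≤ y := le_inf (posBandProj_nonneg v hx) hr
  have h : posBandProj v x ≤ posBandProj v x - y := by
    refine posBandProj_le fun n => ?_
    have hdisj : (x ⊓ n • v) ⊓ y = 0 := by
      refine le_antisymm ?_ (le_inf (le_inf hx (nsmul_nonneg hv n)) hy0)
      rw [← inf_nsmul_eq_zero hr hv (sub_posBandProj_inf hv x) n]
      exact le_inf (inf_le_right.trans inf_le_right) (inf_le_left.trans inf_le_right)
    rw [le_sub_iff_add_le, ← inf_add_sup (x ⊓ n • v) y, hdisj, zero_add]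
    exact sup_le (inf_nsmul_le_posBandProj v x n) inf_le_left
  exact le_antisymm (by simpa using h) hy0

end BandProjection

namespace HJSetup

variable {E : Type*} [AddCommGroup E] [ConditionallyCompleteLattice E]
  [CovariantClass E E (· + ·) (· ≤ ·)] [Module ℝ E] [PosSMulMono ℝ E]

lemma nsmul_mem_G (s : HJSetup E) {x : E} (hx : x ∈ s.G) (n : ℕ) : n • x ∈ s.G := by
  rw [← Nat.cast_smul_eq_nsmul ℝ]
  exact s.G_smul _ x hx

lemma posBandProj_mem_G (s : HJSetup E) {v x : E} (hv : v ∈ s.G) (hx : x ∈ s.G) :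
    posBandProj v x ∈ s.G := by
  refine s.G_ded _ ?_ (Set.range_nonempty _) ⟨x, ?_⟩
  · rintro _ ⟨n, rfl⟩
    exact s.G_inf _ hx _ (s.nsmul_mem_G hv n)
  · rintro _ ⟨n, rfl⟩
    exact inf_le_left

lemma C_nonempty (s : HJSetup E) {q : E} (hq : q ∈ s.B) : (s.C q).Nonempty :=
  ⟨s.ψ q, q, hq, le_rfl, rfl⟩

lemma C_bddAbove (s : HJSetup E) (q : E) : BddAbove (s.C q) := by
  obtain ⟨g, -, hg⟩ := s.ψ_bdd
  refine ⟨g, ?_⟩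
  rintro _ ⟨p, hp, -, rfl⟩
  exact (le_abs_self _).trans (hg p hp)

lemma alpha_mem_G (s : HJSetup E) {q : E} (hq : q ∈ s.B) : s.alpha q ∈ s.G := by
  refine s.G_ded _ ?_ (s.C_nonempty hq) (s.C_bddAbove q)
  rintro _ ⟨p, hp, -, rfl⟩
  exact s.ψ_mem p hp

lemma ψ_le_alpha (s : HJSetup E) {p q : E} (hp : p ∈ s.B) (hpq : p ≤ q) :
    s.ψ p ≤ s.alpha q :=
  le_csSup (s.C_bddAbove q) ⟨p, hp, hpq, rfl⟩

lemma alpha_le (s : HJSetup E) {q c : E} (hq : q ∈ s.B)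
    (h : ∀ p ∈ s.B, p ≤ q → s.ψ p ≤ c) : s.alpha q ≤ c := by
  refine csSup_le (s.C_nonempty hq) ?_
  rintro _ ⟨p, hp, hpq, rfl⟩
  exact h p hp hpq

/-- If `P_k (2ψ(p) - α(q)) ≤ 0` for every `p ≤ q` in `B`, then `P_k α(q) ≤ 0`. -/
lemma bandProj_alpha_nonpos (s : HJSetup E) {q : E} (k : E) (hq : q ∈ s.B)
    (h : ∀ p ∈ s.B, p ≤ q → bandProj k ((s.ψ p + s.ψ p) - s.alpha q) ≤ 0) :
    bandProj k (s.alpha q) ≤ 0 := by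
  set t := bandProj k (s.alpha q) with ht
  have half_add_half (x : E) : (1 / 2 : ℝ) • (x + x) = x := by
    rw [← two_smul ℝ x, smul_smul]
    norm_num
  have hα : s.alpha q ≤ s.alpha q - (1 / 2 : ℝ) • t := by
    refine s.alpha_le hq fun p hp hpq => ?_
    have h1 := h p hp hpq
    rw [bandProj_sub, bandProj_add, sub_nonpos] at h1
    have h2 := sub_bandProj_le_sub_bandProj k (s.ψ_le_alpha hp hpq)
    have h3 : s.ψ p + s.ψ p ≤ (s.alpha q + s.alpha q) - t := by
      convert add_le_add h1 (add_le_add h2 h2) using 1 <;> abel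
    have h4 := smul_le_smul_of_nonneg_left h3 (by norm_num : (0 : ℝ) ≤ 1 / 2)
    rwa [smul_sub, half_add_half, half_add_half] at h4
  have h5 : (1 / 2 : ℝ) • t ≤ 0 := by simpa using hα
  have h6 := add_nonpos h5 h5
  rwa [← smul_add, half_add_half] at h6

end HJSetup

/-- Let `q ∈ B`, `q̂` a maximal element of `M(q)`, `Q` the band projection
onto the band generated by `(α(q) - 2ψ(q̂))⁺` and `k := Q e`. Then `k ∈ K_G(e) ⊆ B`,
and if `k α(q) > 0`, then there exists `p₀ ∈ B` with `p₀ ≤ q` such that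
`k (2ψ(p₀) - α(q))` is not `≤ 0`. -/
theorem hj_existence_one {E : Type*} [AddCommGroup E]
    [ConditionallyCompleteLattice E] [CovariantClass E E (· + ·) (· ≤ ·)]
    [Module ℝ E] [PosSMulMono ℝ E] (s : HJSetup E) (q : E) (hq : q ∈ s.B)
    (qhat : E) (hqhat : qhat ∈ s.M q) (hmax : ∀ p ∈ s.M q, qhat ≤ p → p = qhat)
    (k : E) (hk : k = bandProj ((s.alpha q - (s.ψ qhat + s.ψ qhat)) ⊔ 0) s.e) :
    (IsComponent s.e k ∧ k ∈ s.G ∧ k ∈ s.B) ∧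
    (0 < bandProj k (s.alpha q) →
      ∃ p₀ ∈ s.B, p₀ ≤ q ∧ ¬ bandProj k ((s.ψ p₀ + s.ψ p₀) - s.alpha q) ≤ 0) := by
  set u := (s.alpha q - (s.ψ qhat + s.ψ qhat)) ⊔ 0 with hu
  have hu0 : 0 ≤ u := le_sup_right
  have hψ := s.ψ_mem qhat hqhat.1
  have huG : u ∈ s.G := by
    refine s.G_sup _ ?_ _ s.G_zero
    rw [sub_eq_add_neg]
    exact s.G_add _ (s.alpha_mem_G hq) _ (s.G_neg _ (s.G_add _ hψ _ hψ))
  have hk' : k = posBandProj u s.e := by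
    rw [hk, bandProj_of_nonneg_s2 u s.e_pos.le, abs_of_nonneg hu0]
  have hcomp : IsComponent s.e k := hk' ▸ isComponent_posBandProj hu0 s.e_pos.le
  have hkG : k ∈ s.G := hk' ▸ s.posBandProj_mem_G huG s.e_mem
  refine ⟨⟨hcomp, hkG, s.KG_sub k hcomp hkG⟩, fun hpos => ?_⟩
  by_contra! hcon
  exact hpos.not_ge (s.bandProj_alpha_nonpos k hq hcon)
end

section
/- If p ∈ B with ψ(p) < 0, then there exists v ∈ B with v ≤ p such that v is strongly negative with respect to ψ and ψ(v) ≤ ψ(p). -/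
theorem directedOn_ge_of_isChain {E : Type*} [Preorder E] {f : E → E} {S : Set E}
    (hchain : IsChain (fun a b => b ≤ a ∧ f b ≤ f a) S) : DirectedOn (· ≥ ·) S := by
  intro x hx y hy
  rcases eq_or_ne x y with rfl | hxy
  · exact ⟨x, hx, le_rfl, le_rfl⟩
  · rcases hchain hx hy hxy with h | h
    · exact ⟨y, hy, h.1, le_rfl⟩
    · exact ⟨x, hx, le_rfl, h.1⟩

section LatticeOrderedGroup

variable {E : Type*} [AddCommGroup E] [Lattice E] [CovariantClass E E (· + ·) (· ≤ ·)]

theorem IsLUB.add_inf_le {S : Set E} {a c y t : E} (hc : IsLUB S c)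
    (h : ∀ s ∈ S, (a + s) ⊓ y ≤ t) : (a + c) ⊓ y ≤ t := by
  have key : c ≤ t + (a + c) ⊔ y - y - a := by
    refine hc.2 fun s hs => ?_
    have h1 : (a + s) ⊓ y + (a + s) ⊔ y = a + s + y := inf_add_sup _ _
    have h2 : (a + s) ⊔ y ≤ (a + c) ⊔ y := sup_le_sup_right (add_le_add_right (hc.1 hs) a) y
    have h3 := add_le_add (h s hs) h2
    rw [h1] at h3
    rw [le_sub_iff_add_le, le_sub_iff_add_le]
    calc s + a + y = a + s + y := by abel
      _ ≤ _ := h3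
  have h1 : (a + c) ⊓ y + (a + c) ⊔ y = a + c + y := inf_add_sup _ _
  rw [le_sub_iff_add_le, le_sub_iff_add_le] at key
  have h2 : (a + c) ⊓ y + (a + c) ⊔ y ≤ t + (a + c) ⊔ y := by
    rw [h1]
    calc a + c + y = c + a + y := by abel
      _ ≤ _ := key
  exact le_of_add_le_add_right h2

theorem IsLUB.inf_le_of_forall_inf_le {S : Set E} {c y t : E} (hc : IsLUB S c)
    (h : ∀ s ∈ S, s ⊓ y ≤ t) : c ⊓ y ≤ t := by
  simpa using hc.add_inf_le (a := 0) (by simpa using h)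

theorem nsmul_inf_nonpos {a b : E} (ha : 0 ≤ a) (h : a ⊓ b ≤ 0) (n : ℕ) :
    n • a ⊓ b ≤ 0 := by
  induction n with
  | zero => simp
  | succ n ih =>
    have h1 : (n + 1) • a ⊓ b ≤ n • a := by
      have : (n + 1) • a ⊓ b ≤ (n • a + a) ⊓ (n • a + b) := by
        rw [succ_nsmul]
        exact inf_le_inf_left _ (le_add_of_nonneg_left (nsmul_nonneg ha n))
      rw [← add_inf] at this
      exact this.trans (add_le_of_nonpos_right h)
    exact (le_inf h1 inf_le_right).trans ih

theorem IsComponent.sup_inf_sub {e r v : E} (hr : IsComponent e r) (hv : v ≤ e) (hrv : r ≤ v) :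
    r ⊔ (v ⊓ (e - r)) = v := by
  apply le_antisymm (sup_le hrv inf_le_left)
  have hdisj : r ⊓ (v ⊓ (e - r)) ≤ 0 := by
    rw [← hr.2.2]
    exact inf_le_inf_left _ inf_le_right
  have h1 : r ⊓ (v ⊓ (e - r)) + r ⊔ (v ⊓ (e - r)) = r + v ⊓ (e - r) := inf_add_sup _ _
  have h2 : v ≤ r + v ⊓ (e - r) := by
    rw [add_inf, add_sub_cancel]
    exact le_inf (le_add_of_nonneg_left hr.1) hv
  rw [← h1] at h2
  exact h2.trans (add_le_of_nonpos_left hdisj)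

end LatticeOrderedGroup

section CarrierComponent

variable {E : Type*} [AddCommGroup E] [ConditionallyCompleteLattice E]

/-- The component of `e` generated by the positive element `u`, that is `P_u e`. -/
noncomputable def carrierComponent (e u : E) : E :=
  sSup (Set.range fun n : ℕ => e ⊓ n • u)

theorem isLUB_carrierComponent (e u : E) :
    IsLUB (Set.range fun n : ℕ => e ⊓ n • u) (carrierComponent e u) :=
  isLUB_csSup (Set.range_nonempty _) ⟨e, by rintro _ ⟨n, rfl⟩; exact inf_le_left⟩

theorem inf_nsmul_le_carrierComponent (e u : E) (n : ℕ) :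
    e ⊓ n • u ≤ carrierComponent e u :=
  (isLUB_carrierComponent e u).1 ⟨n, rfl⟩

theorem carrierComponent_nonneg {e : E} (he : 0 ≤ e) (u : E) : 0 ≤ carrierComponent e u := by
  simpa [inf_eq_right.2 he] using inf_nsmul_le_carrierComponent e u 0

variable [CovariantClass E E (· + ·) (· ≤ ·)]

theorem isComponent_carrierComponent {e : E} (he : 0 ≤ e) (u : E) :
    IsComponent e (carrierComponent e u) := by
  have hlub := isLUB_carrierComponent e u
  have hle : carrierComponent e u ≤ e :=
    hlub.2 (by rintro _ ⟨n, rfl⟩; exact inf_le_left)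
  refine ⟨carrierComponent_nonneg he u, hle, le_antisymm ?_
    (le_inf (carrierComponent_nonneg he u) (sub_nonneg.2 hle))⟩
  refine hlub.inf_le_of_forall_inf_le ?_
  rintro _ ⟨n, rfl⟩
  have h : (e ⊓ n • u + carrierComponent e u) ⊓ e ≤ carrierComponent e u := by
    refine hlub.add_inf_le ?_
    rintro _ ⟨m, rfl⟩
    refine le_trans (le_inf inf_le_right (inf_le_left.trans ?_))
      (inf_nsmul_le_carrierComponent e u (n + m))
    rw [add_nsmul]
    exact add_le_add inf_le_right inf_le_right
  rw [← add_le_add_iff_right (carrierComponent e u), zero_add, inf_add, sub_add_cancel]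
  exact h

theorem carrierComponent_inf_nonpos {e u y : E} (hu : 0 ≤ u) (h : u ⊓ y ≤ 0) :
    carrierComponent e u ⊓ y ≤ 0 := by
  refine (isLUB_carrierComponent e u).inf_le_of_forall_inf_le ?_
  rintro _ ⟨n, rfl⟩
  exact (inf_le_inf_right _ inf_le_right).trans (nsmul_inf_nonpos hu h n)

/-- The projection of `x` onto the band of its positive part dominates `x⁺ ⊓ P_{x⁺} e`. -/
theorem inf_carrierComponent_le_bandProj {e : E} (he : 0 ≤ e) (x : E) :
    (x ⊔ 0) ⊓ carrierComponent e (x ⊔ 0) ≤ bandProj (carrierComponent e (x ⊔ 0)) x := by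
  have hc := carrierComponent_nonneg he (x ⊔ 0)
  have hdisj : (x ⊔ 0) ⊓ (-x ⊔ 0) ≤ 0 := (posPart_inf_negPart_eq_zero x).le
  have hcx := carrierComponent_inf_nonpos (e := e) le_sup_right hdisj
  have hneg : sSup (Set.range fun n : ℕ => (-x ⊔ 0) ⊓ n • carrierComponent e (x ⊔ 0)) ≤ 0 := by
    refine csSup_le (Set.range_nonempty _) ?_
    rintro _ ⟨n, rfl⟩
    exact (inf_comm _ _).trans_le <| nsmul_inf_nonpos hc hcx n
  have hpos : (x ⊔ 0) ⊓ carrierComponent e (x ⊔ 0) ≤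
      sSup (Set.range fun n : ℕ => (x ⊔ 0) ⊓ n • carrierComponent e (x ⊔ 0)) :=
    le_csSup ⟨x ⊔ 0, by rintro _ ⟨n, rfl⟩; exact inf_le_left⟩ ⟨1, by simp⟩
  rw [bandProj, abs_of_nonneg hc]
  exact hpos.trans (le_sub_self_iff _ |>.2 hneg)

end CarrierComponent

namespace HJSetup

variable {E : Type*} [AddCommGroup E] [ConditionallyCompleteLattice E]
  [CovariantClass E E (· + ·) (· ≤ ·)] [Module ℝ E] [PosSMulMono ℝ E]

theorem psi_zero (s : HJSetup E) : s.ψ 0 = 0 := by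
  simpa using s.ψ_add 0 s.B_zero 0 s.B_zero (inf_idem 0)

theorem psi_eq_add_psi_diff (s : HJSetup E) {r v : E} (hr : r ∈ s.B) (hv : v ∈ s.B)
    (hrv : r ≤ v) : s.ψ v = s.ψ r + s.ψ (v ⊓ (s.e - r)) := by
  have hrc := s.B_comp r hr
  rw [← s.ψ_add r hr _ (s.B_inf v hv _ (s.B_compl r hr)),
    hrc.sup_inf_sub (s.B_comp v hv).2.1 hrv]
  rw [inf_left_comm, hrc.2.2, inf_eq_right.2 (s.B_comp v hv).1]

theorem carrierComponent_mem_G (s : HJSetup E) {u : E} (hu : u ∈ s.G) :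
    carrierComponent s.e u ∈ s.G := by
  refine s.G_ded _ ?_ (Set.range_nonempty _) ⟨s.e, by rintro _ ⟨n, rfl⟩; exact inf_le_left⟩
  rintro _ ⟨n, rfl⟩
  refine s.G_inf _ s.e_mem _ ?_
  rw [← Nat.cast_smul_eq_nsmul ℝ]
  exact s.G_smul _ _ hu

/-- An element of `B` none of whose nonzero parts has nonnegative `ψ`-value is strongly
negative. -/
theorem stronglyNeg_of_forall_nonneg_imp_eq_zero (s : HJSetup E) {v : E}
    (h : ∀ r ∈ s.B, r ≤ v → 0 ≤ s.ψ r → r = 0) : s.StronglyNeg v := by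
  intro r hr hrv
  have he : 0 ≤ s.e := s.e_pos.le
  set u := s.ψ r ⊔ 0 with hu
  set c := carrierComponent s.e u with hc
  have hcG : c ∈ s.G := s.carrierComponent_mem_G (s.G_sup _ (s.ψ_mem r hr) _ s.G_zero)
  have hcc : IsComponent s.e c := isComponent_carrierComponent he u
  have hle : u ⊓ c ≤ s.ψ (r ⊓ c) := by
    rw [s.ψ_mul r hr c hcc hcG]
    exact inf_carrierComponent_le_bandProj he (s.ψ r)
  have hu0 : 0 ≤ u := le_sup_right
  have hrc : r ⊓ c = 0 :=
    h _ (s.B_inf r hr c (s.KG_sub c hcc hcG)) (inf_le_left.trans hrv)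
      ((le_inf hu0 hcc.1).trans hle)
  rw [hrc, s.psi_zero] at hle
  have hec : s.e ⊓ u ≤ c := by simpa using inf_nsmul_le_carrierComponent s.e u 1
  have hue : u ⊓ s.e = 0 := le_antisymm
    ((le_inf inf_le_left (by rwa [inf_comm])).trans hle) (le_inf hu0 he)
  exact sup_eq_right.1 (s.e_weak u hu0 hue)

/-- If `ψ` is monotone along a chain in `B`, then `ψ` of the infimum is a lower bound. -/
theorem psi_sInf_le (s : HJSetup E) {S : Set E} (hSB : S ⊆ s.B) (hS : S.Nonempty)
    (hchain : IsChain (fun a b => b ≤ a ∧ s.ψ b ≤ s.ψ a) S) {a : E} (ha : a ∈ S) :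
    s.ψ (sInf S) ≤ s.ψ a := by
  have hdir := directedOn_ge_of_isChain hchain
  obtain ⟨w, hmono, hinf, hw⟩ := s.ψ_ordCont S hSB hS hdir
  have hsub : ∀ b ∈ S, s.ψ b ≤ s.ψ a → s.ψ (sInf S) - s.ψ a ≤ w b := fun b hb hba =>
    calc s.ψ (sInf S) - s.ψ a ≤ s.ψ (sInf S) - s.ψ b := sub_le_sub_left hba _
      _ ≤ |s.ψ b - s.ψ (sInf S)| := by rw [abs_sub_comm]; exact le_abs_self _
      _ ≤ w b := hw b hb
  rw [← sub_nonpos, ← hinf]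
  refine le_csInf (hS.image w) ?_
  rintro _ ⟨b, hb, rfl⟩
  rcases eq_or_ne a b with rfl | hab
  · exact hsub a ha le_rfl
  · rcases hchain ha hb hab with h | h
    · exact hsub b hb h.2
    · exact (hsub a ha le_rfl).trans (hmono a ha b hb h.1)

/-- Below every `p ∈ B` there is an element of `B` minimal for the order
`a ≤ b ∧ ψ a ≤ ψ b`. -/
theorem exists_minimal (s : HJSetup E) {p : E} (hp : p ∈ s.B) :
    ∃ v ∈ s.B, v ≤ p ∧ s.ψ v ≤ s.ψ p ∧
      ∀ r ∈ s.B, r ≤ v → s.ψ r ≤ s.ψ v → r = v := by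
  let T := {v : E // v ∈ s.B ∧ v ≤ p ∧ s.ψ v ≤ s.ψ p}
  let R : T → T → Prop := fun a b => b.1 ≤ a.1 ∧ s.ψ b.1 ≤ s.ψ a.1
  obtain ⟨⟨v, hv, hvp, hvψ⟩, hmin⟩ : ∃ m : T, ∀ a, R m a → R a m := by
    refine exists_maximal_of_chains_bounded (fun c hc => ?_)
      (fun hab hbc => ⟨hbc.1.trans hab.1, hbc.2.trans hab.2⟩)
    rcases c.eq_empty_or_nonempty with rfl | ⟨a₀, ha₀⟩
    · exact ⟨⟨p, hp, le_rfl, le_rfl⟩, by simp⟩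
    let S : Set E := Subtype.val '' c
    have hSB : S ⊆ s.B := by rintro _ ⟨a, -, rfl⟩; exact a.2.1
    have hS : S.Nonempty := ⟨a₀, a₀, ha₀, rfl⟩
    have hchain : IsChain (fun a b => b ≤ a ∧ s.ψ b ≤ s.ψ a) S := by
      rintro _ ⟨a, ha, rfl⟩ _ ⟨b, hb, rfl⟩ hab
      exact hc ha hb fun h => hab (congrArg _ h)
    have hdir := directedOn_ge_of_isChain hchain
    have hle : ∀ a ∈ c, sInf S ≤ a.1 := fun a ha =>
      csInf_le ⟨0, fun x hx => (s.B_comp x (hSB hx)).1⟩ ⟨a, ha, rfl⟩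
    have hψ : ∀ a ∈ c, s.ψ (sInf S) ≤ s.ψ a.1 := fun a ha =>
      s.psi_sInf_le hSB hS hchain ⟨a, ha, rfl⟩
    exact ⟨⟨sInf S, s.B_orderClosed S hSB hS hdir, (hle a₀ ha₀).trans a₀.2.2.1,
      (hψ a₀ ha₀).trans a₀.2.2.2⟩, fun a ha => ⟨hle a ha, hψ a ha⟩⟩
  exact ⟨v, hv, hvp, hvψ, fun r hr hrv hψ => le_antisymm hrv
    (hmin ⟨r, hr, hrv.trans hvp, hψ.trans hvψ⟩ ⟨hrv, hψ⟩).1⟩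

end HJSetup

/-- If `p ∈ B` with `ψ(p) < 0` then there exists `v ∈ B` with `v ≤ p`,
`v` strongly negative with respect to `ψ`, and `ψ(v) ≤ ψ(p)`. -/
theorem hj_strongly {E : Type*} [AddCommGroup E]
    [ConditionallyCompleteLattice E] [CovariantClass E E (· + ·) (· ≤ ·)]
    [Module ℝ E] [PosSMulMono ℝ E] (s : HJSetup E) (p : E) (hp : p ∈ s.B)
    (hneg : s.ψ p < 0) :
    ∃ v ∈ s.B, v ≤ p ∧ s.StronglyNeg v ∧ s.ψ v ≤ s.ψ p := by
  obtain ⟨v, hv, hvp, hvψ, hmin⟩ := s.exists_minimal hp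
  refine ⟨v, hv, hvp, s.stronglyNeg_of_forall_nonneg_imp_eq_zero fun r hr hrv hψ => ?_, hvψ⟩
  have hrc := s.B_comp r hr
  have hdiff : v ⊓ (s.e - r) = v := by
    refine hmin _ (s.B_inf v hv _ (s.B_compl r hr)) inf_le_left ?_
    rw [s.psi_eq_add_psi_diff hr hv hrv]
    exact le_add_of_nonneg_left hψ
  rw [← inf_eq_left.2 (hrv.trans (inf_eq_left.1 hdiff))]
  exact hrc.2.2
end

section
/- If ψ(q) is not ≥ 0 for some q ∈ B, then there exists v ∈ B with v ≤ q such that v is strongly negative with respect to ψ and ψ(v) ≤ −ψ(q)⁻ (where ψ(q)⁻ is the negative part of ψ(q)). -/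
section RieszSpace

variable {E : Type*} [AddCommGroup E]

/-- One half of the infinite distributive law in a lattice ordered group. -/
theorem inf_le_of_isLUB_of_forall_inf_le [Lattice E] [AddLeftMono E] {T : Set E} {a b c : E}
    (hc : IsLUB T c) (h : ∀ t ∈ T, a ⊓ t ≤ b) : a ⊓ c ≤ b := by
  have key : c ≤ b + (a ⊔ c) - a := by
    refine hc.2 fun t ht => ?_
    have h1 : t = a ⊓ t + (a ⊔ t) - a := by rw [inf_add_sup]; abel
    rw [h1]
    exact sub_le_sub_right (add_le_add (h t ht) (sup_le_sup_left (hc.1 ht) a)) a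
  have h2 : a ⊓ c = c - (a ⊔ c) + a := by
    rw [eq_sub_of_add_eq (inf_add_sup a c)]; abel
  rw [h2]
  calc c - (a ⊔ c) + a ≤ b + (a ⊔ c) - a - (a ⊔ c) + a := by gcongr
    _ = b := by abel

theorem inf_nsmul_le_zero [Lattice E] [AddLeftMono E] {a c : E} (ha : 0 ≤ a) (hc : 0 ≤ c)
    (h : a ⊓ c ≤ 0) (n : ℕ) : a ⊓ n • c ≤ 0 := by
  induction n with
  | zero => simp
  | succ n ih =>
    have hn : 0 ≤ n • c := nsmul_nonneg hc n
    calc a ⊓ (n + 1) • c ≤ (a ⊓ n • c) + (a ⊓ c) := by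
          rw [inf_add, add_inf, add_inf, succ_nsmul]
          refine le_inf (le_inf ?_ ?_) (le_inf ?_ ?_)
          · exact inf_le_left.trans (le_add_of_nonneg_left ha)
          · exact inf_le_left.trans (le_add_of_nonneg_right hc)
          · exact inf_le_left.trans (le_add_of_nonneg_left hn)
          · exact inf_le_right
      _ ≤ 0 := add_nonpos ih h

/-- If `u` is a component of `e`, then `e` is the supremum of `u` and `e - u`. -/
theorem IsComponent.isLUB_pair [Lattice E] [AddLeftMono E] {e u : E} (h : IsComponent e u) :
    IsLUB {u, e - u} e := by
  have h1 : u ⊔ (e - u) = e := by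
    have := inf_add_sup u (e - u)
    rwa [h.2.2, zero_add, add_sub_cancel] at this
  have h2 : IsLUB {u, e - u} (u ⊔ (e - u)) := _root_.isLUB_pair
  rwa [h1] at h2

variable [ConditionallyCompleteLattice E]

/-- The component of `e` in the band generated by `y`. -/
noncomputable def bandComponent (e y : E) : E := sSup (Set.range fun n : ℕ => e ⊓ n • y)

theorem isLUB_bandComponent (e y : E) :
    IsLUB (Set.range fun n : ℕ => e ⊓ n • y) (bandComponent e y) :=
  isLUB_csSup (Set.range_nonempty _) ⟨e, by rintro _ ⟨n, rfl⟩; exact inf_le_left⟩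

theorem bandComponent_nonneg {e : E} (he : 0 ≤ e) (y : E) : 0 ≤ bandComponent e y :=
  (isLUB_bandComponent e y).1 ⟨0, by simpa using he⟩

theorem inf_le_bandComponent (e y : E) : e ⊓ y ≤ bandComponent e y :=
  (isLUB_bandComponent e y).1 ⟨1, by simp⟩

variable [AddLeftMono E]

theorem isComponent_bandComponent {e : E} (he : 0 ≤ e) (y : E) :
    IsComponent e (bandComponent e y) := by
  have hlub := isLUB_bandComponent e y
  set c := bandComponent e y
  have hc0 : 0 ≤ c := bandComponent_nonneg he y
  have hce : c ≤ e := hlub.2 (by rintro _ ⟨n, rfl⟩; exact inf_le_left)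
  refine ⟨hc0, hce, le_antisymm ?_ (le_inf hc0 (sub_nonneg.2 hce))⟩
  have key : c ≤ c - (e - c) ⊓ c := by
    refine hlub.2 ?_
    rintro _ ⟨n, rfl⟩
    rw [le_sub_comm]
    refine inf_le_of_isLUB_of_forall_inf_le hlub ?_
    rintro _ ⟨m, rfl⟩
    rw [le_sub_iff_add_le]
    have hn : e ⊓ n • y ≤ c := hlub.1 ⟨n, rfl⟩
    refine le_trans (le_inf ?_ ?_) (hlub.1 ⟨m + n, rfl⟩)
    · calc _ ≤ (e - c) + c := add_le_add inf_le_left hn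
        _ = e := sub_add_cancel e c
    · rw [add_nsmul]
      exact add_le_add (inf_le_right.trans inf_le_right) inf_le_right
  rw [inf_comm]
  simpa using key

/-- Disjointness passes to the band generated by an element. -/
theorem inf_bandComponent_le_zero {e a y : E} (ha : 0 ≤ a) (hy : 0 ≤ y) (h : a ⊓ y ≤ 0) :
    a ⊓ bandComponent e y ≤ 0 := by
  refine inf_le_of_isLUB_of_forall_inf_le (isLUB_bandComponent e y) ?_
  rintro _ ⟨n, rfl⟩
  exact (inf_le_inf_left a inf_le_right).trans (inf_nsmul_le_zero ha hy h n)

theorem inf_le_bandProj_bandComponent {e : E} (he : 0 ≤ e) (x : E) :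
    e ⊓ (x ⊔ 0) ≤ bandProj (bandComponent e (x ⊔ 0)) x := by
  set c := bandComponent e (x ⊔ 0)
  have hc0 : 0 ≤ c := bandComponent_nonneg he _
  have hdisj : ((-x) ⊔ 0) ⊓ (x ⊔ 0) ≤ 0 := by
    have := posPart_inf_negPart_eq_zero x
    rw [inf_comm]
    exact this.le
  have hneg : sSup (Set.range fun n : ℕ => ((-x) ⊔ 0) ⊓ n • |c|) ≤ 0 := by
    refine csSup_le (Set.range_nonempty _) ?_
    rintro _ ⟨n, rfl⟩
    rw [abs_of_nonneg hc0]
    exact inf_nsmul_le_zero le_sup_right hc0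
      (inf_bandComponent_le_zero le_sup_right le_sup_right hdisj) n
  have hpos : e ⊓ (x ⊔ 0) ≤ sSup (Set.range fun n : ℕ => (x ⊔ 0) ⊓ n • |c|) := by
    refine le_csSup_of_le ⟨x ⊔ 0, ?_⟩ ⟨1, rfl⟩ ?_
    · rintro _ ⟨n, rfl⟩
      exact inf_le_left
    · simp only [one_nsmul, abs_of_nonneg hc0]
      exact le_inf inf_le_right (inf_le_bandComponent e _)
  unfold bandProj
  exact hpos.trans (le_sub_self_iff _ |>.2 hneg)

end RieszSpace

namespace HJSetup

variable {E : Type*} [AddCommGroup E] [ConditionallyCompleteLattice E]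
  [CovariantClass E E (· + ·) (· ≤ ·)] [Module ℝ E] [PosSMulMono ℝ E] (s : HJSetup E)

theorem bandComponent_mem_G {x : E} (hx : x ∈ s.G) : bandComponent s.e x ∈ s.G := by
  have hn : ∀ n : ℕ, n • x ∈ s.G := by
    intro n
    induction n with
    | zero => simpa using s.G_zero
    | succ n ih => rw [succ_nsmul]; exact s.G_add _ ih _ hx
  refine s.G_ded _ ?_ (Set.range_nonempty _) (isLUB_bandComponent s.e x).bddAbove
  rintro _ ⟨n, rfl⟩
  exact s.G_inf _ s.e_mem _ (hn n)

/-- A component on which `ψ` is not `≤ 0` has a part on which `ψ` is positive and nonzero. -/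
theorem exists_pos_le {p : E} (hp : p ∈ s.B) (h : ¬ s.ψ p ≤ 0) :
    ∃ u ∈ s.B, u ≤ p ∧ 0 ≤ s.ψ u ∧ s.ψ u ≠ 0 := by
  have he := s.e_pos.le
  have hc := isComponent_bandComponent he (s.ψ p ⊔ 0)
  have hcG := s.bandComponent_mem_G (s.G_sup _ (s.ψ_mem p hp) _ s.G_zero)
  have hle := inf_le_bandProj_bandComponent he (s.ψ p)
  rw [← s.ψ_mul p hp _ hc hcG] at hle
  have h0 : 0 ≤ s.e ⊓ (s.ψ p ⊔ 0) := le_inf he le_sup_right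
  refine ⟨_, s.B_inf _ hp _ (s.KG_sub _ hc hcG), inf_le_left, h0.trans hle, fun h1 => h ?_⟩
  have h2 := s.e_weak (s.ψ p ⊔ 0) le_sup_right
    (by rw [inf_comm]; exact le_antisymm (hle.trans h1.le) h0)
  exact le_sup_left.trans h2.le

theorem ψ_eq_add_of_le {u v : E} (hu : u ∈ s.B) (hv : v ∈ s.B) (huv : u ≤ v) :
    s.ψ v = s.ψ (v ⊓ (s.e - u)) + s.ψ u := by
  have hcomp := s.B_comp u hu
  rw [← s.ψ_add _ (s.B_inf _ hv _ (s.B_compl u hu)) _ hu]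
  · congr 1
    refine le_antisymm ?_ (sup_le inf_le_left huv)
    calc v = v ⊓ s.e := (inf_eq_left.2 (s.B_comp v hv).2.1).symm
      _ ≤ _ := by
        refine inf_le_of_isLUB_of_forall_inf_le hcomp.isLUB_pair ?_
        rintro t (rfl | rfl)
        · exact inf_le_right.trans le_sup_right
        · exact le_sup_left
  · refine le_antisymm ?_ (le_inf (le_inf (hcomp.1.trans huv) (sub_nonneg.2 hcomp.2.1)) hcomp.1)
    calc _ ≤ (s.e - u) ⊓ u := inf_le_inf_right u inf_le_right
      _ = 0 := by rw [inf_comm]; exact hcomp.2.2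

theorem directedOn_of_isChain {S : Set E}
    (hchain : IsChain (fun a b => b ≤ a ∧ s.ψ b ≤ s.ψ a) S) : DirectedOn (· ≥ ·) S := by
  intro a ha b hb
  rcases eq_or_ne a b with rfl | hab
  · exact ⟨a, ha, le_rfl, le_rfl⟩
  · rcases hchain ha hb hab with h | h
    · exact ⟨b, hb, h.1, le_rfl⟩
    · exact ⟨a, ha, le_rfl, h.1⟩

/-- If `ψ` decreases along a chain of components, its value at the infimum is a lower bound. -/
theorem ψ_sInf_le {S : Set E} (hS : S ⊆ s.B)
    (hchain : IsChain (fun a b => b ≤ a ∧ s.ψ b ≤ s.ψ a) S) {p : E} (hp : p ∈ S) :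
    s.ψ (sInf S) ≤ s.ψ p := by
  obtain ⟨w, hmono, hinf, hw⟩ := s.ψ_ordCont S hS ⟨p, hp⟩
    (s.directedOn_of_isChain hchain)
  have hb : ∀ r ∈ S, s.ψ (sInf S) - s.ψ r ≤ w r := fun r hr =>
    (neg_sub (s.ψ r) _ ▸ neg_le_abs _ : s.ψ (sInf S) - s.ψ r ≤ |s.ψ r - s.ψ (sInf S)|).trans
      (hw r hr)
  rw [← sub_nonpos, ← hinf]
  refine le_csInf ⟨_, p, hp, rfl⟩ ?_
  rintro _ ⟨r, hr, rfl⟩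
  rcases eq_or_ne p r with rfl | hpr
  · exact hb p hp
  · rcases hchain hp hr hpr with h | h
    · exact (sub_le_sub_left h.2 _).trans (hb r hr)
    · exact (hb p hp).trans (hmono p hp r hr h.1)

/-- Below every component there is one which is minimal for simultaneous decrease of the
component and of its value under `ψ`. -/
theorem exists_minimal_le {q : E} (hq : q ∈ s.B) :
    ∃ v ∈ s.B, v ≤ q ∧ s.ψ v ≤ s.ψ q ∧
      ∀ u ∈ s.B, u ≤ v → s.ψ u ≤ s.ψ v → v ≤ u ∧ s.ψ v ≤ s.ψ u := by
  let A := {v : E // v ∈ s.B ∧ v ≤ q ∧ s.ψ v ≤ s.ψ q}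
  let r : A → A → Prop := fun a b => b.1 ≤ a.1 ∧ s.ψ b.1 ≤ s.ψ a.1
  have hbdd : ∀ c, IsChain r c → ∃ ub, ∀ a ∈ c, r a ub := by
    intro c hc
    rcases c.eq_empty_or_nonempty with rfl | ⟨a, ha⟩
    · exact ⟨⟨q, hq, le_rfl, le_rfl⟩, by simp⟩
    have hS : Subtype.val '' c ⊆ s.B := by
      rintro _ ⟨b, -, rfl⟩
      exact b.2.1
    have hchain : IsChain (fun a b => b ≤ a ∧ s.ψ b ≤ s.ψ a) (Subtype.val '' c) := by
      rintro _ ⟨x, hx, rfl⟩ _ ⟨y, hy, rfl⟩ hxy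
      exact hc hx hy fun h => hxy (congrArg _ h)
    have hle : ∀ b ∈ c, sInf (Subtype.val '' c) ≤ b.1 := fun b hb =>
      csInf_le ⟨0, fun t ht => (s.B_comp t (hS ht)).1⟩ ⟨b, hb, rfl⟩
    have hψ : ∀ b ∈ c, s.ψ (sInf (Subtype.val '' c)) ≤ s.ψ b.1 := fun b hb =>
      s.ψ_sInf_le hS hchain ⟨b, hb, rfl⟩
    exact ⟨⟨sInf (Subtype.val '' c), s.B_orderClosed _ hS ⟨_, a, ha, rfl⟩
      (s.directedOn_of_isChain hchain),
      (hle a ha).trans a.2.2.1, (hψ a ha).trans a.2.2.2⟩, fun b hb => ⟨hle b hb, hψ b hb⟩⟩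
  obtain ⟨m, hm⟩ := exists_maximal_of_chains_bounded hbdd
    (fun hab hbc => ⟨hbc.1.trans hab.1, hbc.2.trans hab.2⟩)
  exact ⟨m.1, m.2.1, m.2.2.1, m.2.2.2, fun u hu huv hψ =>
    hm ⟨u, hu, huv.trans m.2.2.1, hψ.trans m.2.2.2⟩ ⟨huv, hψ⟩⟩

end HJSetup

/-- If `ψ(q)` is not `≥ 0` for some `q ∈ B`, then there exists `v ∈ B`
with `v ≤ q` such that `v` is strongly negative with respect to `ψ` and
`ψ(v) ≤ -ψ(q)⁻`, where `ψ(q)⁻ = (-ψ(q)) ⊔ 0` is the negative part of `ψ(q)`. -/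
theorem hj_existence {E : Type*} [AddCommGroup E]
    [ConditionallyCompleteLattice E] [CovariantClass E E (· + ·) (· ≤ ·)]
    [Module ℝ E] [PosSMulMono ℝ E] (s : HJSetup E) (q : E) (hq : q ∈ s.B)
    (h : ¬ 0 ≤ s.ψ q) :
    ∃ v ∈ s.B, v ≤ q ∧ s.StronglyNeg v ∧ s.ψ v ≤ -((-s.ψ q) ⊔ 0) := by
  obtain ⟨v, hv, hvq, hψ, hmin⟩ := s.exists_minimal_le hq
  have hneg : s.StronglyNeg v := by
    intro p hp hpv
    by_contra hpos
    obtain ⟨u, hu, hup, hu0, hne⟩ := s.exists_pos_le hp hpos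
    have hadd := s.ψ_eq_add_of_le hu hv (hup.trans hpv)
    have hle := (hmin _ (s.B_inf _ hv _ (s.B_compl u hu)) inf_le_left
      (hadd ▸ le_add_of_nonneg_right hu0)).2
    rw [hadd] at hle
    exact hne (le_antisymm ((add_le_iff_nonpos_right _).1 hle) hu0)
  refine ⟨v, hv, hvq, hneg, ?_⟩
  rw [neg_sup, neg_neg, neg_zero]
  exact le_inf hψ (hneg v hv le_rfl)
end
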